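/- Let G be a finite abelian group with exp(G) = n and rank r, and let G₀ ⊆ G be a minimal non-half-factorial LCN-set with |G₀| ≥ r + 2 such that for every h ∈ G₀, h ∈ ⟨G₀ \ {h}⟩ but h ∉ ⟨G₀ \ {h, h'}⟩ for any h' ∈ G₀ \ {h}. Then |G₀| ≤ r + n/2. -/

import Mathlib

/-- A sequence over `G₀` (a multiset with entries in `G₀`) with sum zero. -/
def IsZeroSumSeq {G : Type*} [AddCommGroup G] (G₀ : Set G) (S : Multiset G) : Prop :=
  (∀ g ∈ S, g ∈ G₀) ∧ S.sum = 0

/-- A minimal zero-sum sequence (atom) over `G₀`. -/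
def IsAtomSeq {G : Type*} [AddCommGroup G] (G₀ : Set G) (A : Multiset G) : Prop :=
  IsZeroSumSeq G₀ A ∧ A ≠ 0 ∧ ∀ B ≤ A, B ≠ 0 → B.sum = 0 → B = A

/-- The set of lengths of factorizations of `B` into atoms over `G₀`. -/
def LengthSet {G : Type*} [AddCommGroup G] (G₀ : Set G) (B : Multiset G) : Set ℕ :=
  {k | ∃ F : Multiset (Multiset G), F.card = k ∧ (∀ A ∈ F, IsAtomSeq G₀ A) ∧ F.sum = B}

/-- The set of successive distances of a set of naturals. -/
def DistSet (L : Set ℕ) : Set ℕ :=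
  {d | ∃ a b, a ∈ L ∧ b ∈ L ∧ a < b ∧ b - a = d ∧ ∀ c ∈ L, ¬(a < c ∧ c < b)}

/-- The set of distances `Δ(G₀)`. -/
def DeltaSet {G : Type*} [AddCommGroup G] (G₀ : Set G) : Set ℕ :=
  {d | ∃ B : Multiset G, IsZeroSumSeq G₀ B ∧ d ∈ DistSet (LengthSet G₀ B)}

/-- The cross number of a sequence. -/
noncomputable def crossNum {G : Type*} [AddCommGroup G] (S : Multiset G) : ℚ :=
  (S.map (fun g => (1 : ℚ) / addOrderOf g)).sum

/-- `G₀` is an LCN-set: every atom has cross number at least 1. -/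
def IsLCNSet {G : Type*} [AddCommGroup G] (G₀ : Set G) : Prop :=
  ∀ A : Multiset G, IsAtomSeq G₀ A → 1 ≤ crossNum A

/-- The set of minimal distances `Δ*(G)`. -/
def DeltaStar (G : Type*) [AddCommGroup G] : Set ℕ :=
  {d | ∃ G₀ : Set G, DeltaSet G₀ ≠ ∅ ∧ d = sInf (DeltaSet G₀)}

/-- `m(G)`: the maximum of `min Δ(G₀)` over non-half-factorial LCN-sets `G₀`. -/
noncomputable def mConst (G : Type*) [AddCommGroup G] : ℕ :=
  sSup {d | ∃ G₀ : Set G, IsLCNSet G₀ ∧ DeltaSet G₀ ≠ ∅ ∧ d = sInf (DeltaSet G₀)}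

/-- The rank of a finite abelian group: the maximal `k` such that `(ZMod p)^k`
embeds into `G` for some prime `p`. -/
noncomputable def grank (G : Type*) [AddCommGroup G] : ℕ :=
  sSup {k | ∃ p : ℕ, p.Prime ∧ ∃ f : (Fin k → ZMod p) →+ G, Function.Injective f}

/-- The system of sets of lengths `L(G)`. -/
def SystemSets (G : Type*) [AddCommGroup G] : Set (Set ℕ) :=
  {L | ∃ B : Multiset G, B.sum = 0 ∧ L = LengthSet Set.univ B}

/-- The Davenport constant: the maximal length of a minimal zero-sum sequence. -/
noncomputable def DavenportC (G : Type*) [AddCommGroup G] : ℕ :=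
  sSup {k | ∃ A : Multiset G, IsAtomSeq (Set.univ : Set G) A ∧ A.card = k}

/-- Every element of a zero-sum sequence lies in an atom dividing the sequence. -/
lemma exists_isAtomSeq_le {G : Type*} [AddCommGroup G] {G₀ : Set G} {B : Multiset G}
    (hB : IsZeroSumSeq G₀ B) {h : G} (hh : h ∈ B) :
    ∃ A ≤ B, IsAtomSeq G₀ A ∧ h ∈ A := by
  classical
  induction B using Multiset.strongInductionOn with
  | ih B ih =>
    by_cases hmin : ∀ C ≤ B, C ≠ 0 → C.sum = 0 → C = B
    · exact ⟨B, le_rfl, ⟨hB, fun h0 => by simp [h0] at hh, hmin⟩, hh⟩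
    · push Not at hmin
      obtain ⟨C, hCB, hC0, hCs, hne⟩ := hmin
      obtain ⟨D, rfl⟩ := Multiset.le_iff_exists_add.1 hCB
      have hD0 : D ≠ 0 := fun h0 => hne (by simp [h0])
      have hDs : D.sum = 0 := by simpa [hCs] using hB.2
      rcases Multiset.mem_add.1 hh with hm | hm
      · obtain ⟨A, hA, hA'⟩ := ih C (lt_of_le_of_ne hCB hne)
          ⟨fun g hg => hB.1 g (Multiset.mem_add.2 (Or.inl hg)), hCs⟩ hm
        exact ⟨A, hA.trans hCB, hA'⟩
      · have hlt : D < C + D := lt_of_le_of_ne (Multiset.le_add_left _ _)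
          (fun he => hC0 (by simpa using he))
        obtain ⟨A, hA, hA'⟩ := ih D hlt
          ⟨fun g hg => hB.1 g (Multiset.mem_add.2 (Or.inr hg)), hDs⟩ hm
        exact ⟨A, hA.trans hlt.le, hA'⟩

/-- Over a half-factorial set, all factorizations of an element have the same length. -/
lemma eq_of_mem_lengthSet {G : Type*} [AddCommGroup G] {G₀ : Set G} (hΔ : DeltaSet G₀ = ∅)
    {B : Multiset G} (hB : IsZeroSumSeq G₀ B) {a b : ℕ} (ha : a ∈ LengthSet G₀ B)
    (hb : b ∈ LengthSet G₀ B) : a = b := by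
  classical
  wlog hab : a < b generalizing a b
  · by_contra hne
    exact hne (this hb ha (by omega)).symm
  exfalso
  have hex : ∃ c, c ∈ LengthSet G₀ B ∧ a < c := ⟨b, hb, hab⟩
  have hmem : Nat.find hex - a ∈ DeltaSet G₀ :=
    ⟨B, hB, a, Nat.find hex, ha, (Nat.find_spec hex).1, (Nat.find_spec hex).2, rfl,
      fun c hc hlt => Nat.find_min hex hlt.2 ⟨hc, hlt.1⟩⟩
  rw [hΔ] at hmem
  exact hmem

lemma isAtomSeq_replicate_addOrderOf {G : Type*} [AddCommGroup G] [Finite G] {G₀ : Set G} {g : G}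
    (hg : g ∈ G₀) : IsAtomSeq G₀ (Multiset.replicate (addOrderOf g) g) := by
  refine ⟨⟨fun x hx => (Multiset.eq_of_mem_replicate hx) ▸ hg, by simp⟩, ?_, ?_⟩
  · intro h0
    have := congrArg Multiset.card h0
    simp only [Multiset.card_replicate, Multiset.card_zero] at this
    exact (addOrderOf_pos g).ne' this
  · intro B hB hB0 hBs
    obtain ⟨k, hk, rfl⟩ := Multiset.le_replicate_iff.1 hB
    have hk0 : k ≠ 0 := fun h0 => hB0 (by simp [h0])
    have : addOrderOf g ∣ k := addOrderOf_dvd_iff_nsmul_eq_zero.2 (by simpa using hBs)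
    rw [le_antisymm hk (Nat.le_of_dvd (Nat.pos_of_ne_zero hk0) this)]

/-- Over a half-factorial set, the length of an atom is at most the exponent of the group. -/
lemma IsAtomSeq.card_le_exponent {G : Type*} [AddCommGroup G] [Finite G] {G₀ : Set G}
    (hΔ : DeltaSet G₀ = ∅) {A : Multiset G} (hA : IsAtomSeq G₀ A) :
    A.card ≤ AddMonoid.exponent G := by
  set n := AddMonoid.exponent G with hn
  have hnpos : 0 < n := AddMonoid.exponent_pos.2 AddMonoid.ExponentExists.of_finite
  have hB : IsZeroSumSeq G₀ (n • A) :=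
    ⟨fun g hg => hA.1.1 g (Multiset.mem_of_mem_nsmul hg), by simp [Multiset.sum_nsmul, hA.1.2]⟩
  have h1 : n ∈ LengthSet G₀ (n • A) :=
    ⟨Multiset.replicate n A, by simp, fun C hC => Multiset.eq_of_mem_replicate hC ▸ hA, by simp⟩
  have h2 : (A.map fun g => n / addOrderOf g).sum ∈ LengthSet G₀ (n • A) := by
    refine ⟨A.bind fun g =>
      Multiset.replicate (n / addOrderOf g) (Multiset.replicate (addOrderOf g) g), ?_, ?_, ?_⟩
    · simp [Multiset.card_bind]
    · intro C hC
      obtain ⟨g, hg, hC⟩ := Multiset.mem_bind.1 hC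
      exact Multiset.eq_of_mem_replicate hC ▸ isAtomSeq_replicate_addOrderOf (hA.1.1 g hg)
    · rw [Multiset.sum_bind]
      have : ∀ g : G, (Multiset.replicate (n / addOrderOf g)
          (Multiset.replicate (addOrderOf g) g)).sum = n • ({g} : Multiset G) := by
        intro g
        rw [Multiset.sum_replicate, Multiset.nsmul_replicate, Multiset.nsmul_singleton,
          Nat.div_mul_cancel (AddMonoid.addOrder_dvd_exponent g)]
      simp only [this]
      rw [Multiset.sum_map_nsmul, Multiset.sum_map_singleton]
  have h3 := eq_of_mem_lengthSet hΔ hB h1 h2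
  calc A.card = (A.map fun _ => 1).sum := by simp
    _ ≤ (A.map fun g => n / addOrderOf g).sum :=
      Multiset.sum_map_le_sum_map _ _ fun g _ => Nat.div_pos
        (Nat.le_of_dvd hnpos (AddMonoid.addOrder_dvd_exponent g)) (addOrderOf_pos g)
    _ = n := h3.symm

lemma le_grank_of_injective {G : Type*} [AddCommGroup G] [Finite G] {p k : ℕ} (hp : p.Prime)
    (f : (Fin k → ZMod p) →+ G) (hf : Function.Injective f) : k ≤ grank G := by
  refine le_csSup ⟨Nat.card G, ?_⟩ ⟨p, hp, f, hf⟩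
  rintro j ⟨q, hq, f, hf⟩
  have : Fact q.Prime := ⟨hq⟩
  have h := Nat.card_le_card_of_injective f hf
  rw [Nat.card_fun, Nat.card_zmod, Nat.card_fin] at h
  exact (Nat.lt_pow_self hq.one_lt).le.trans h

lemma exists_injective_of_linearIndependent {K V W : Type*} [AddCommGroup K] [Finite K] {p : ℕ}
    [Fact p.Prime] [AddCommGroup V] [Module (ZMod p) V] [AddCommGroup W] [Module (ZMod p) W]
    (π : K →+ V) (hπ : Function.Surjective π) (hker : π.ker = (nsmulAddMonoidHom (α := K) p).range)
    (i : W →+ K) (hi : Function.Injective i) (hrange : i.range = (nsmulAddMonoidHom (α := K) p).ker)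
    {ι : Type*} [Fintype ι] {v : ι → V} (hv : LinearIndependent (ZMod p) v) :
    ∃ f : (Fin (Fintype.card ι) → ZMod p) →+ K, Function.Injective f := by
  have : Finite V := Finite.of_surjective π hπ
  have : Finite W := Finite.of_injective i hi
  set N : K →+ K := nsmulAddMonoidHom p
  have hcard : Nat.card V = Nat.card W := by
    have e1 : Nat.card V * Nat.card N.range = Nat.card K := by
      rw [← hker, ← AddSubgroup.card_mul_index π.ker, mul_comm, AddSubgroup.index_ker,
        AddMonoidHom.range_eq_top.2 hπ]
      simp
    have e2 : Nat.card W * Nat.card N.range = Nat.card K := by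
      rw [Nat.card_congr (AddMonoidHom.ofInjective hi).toEquiv, hrange,
        ← AddSubgroup.index_ker, AddSubgroup.card_mul_index]
    exact Nat.eq_of_mul_eq_mul_right Nat.card_pos (e1.trans e2.symm)
  have hrank : Module.finrank (ZMod p) V = Module.finrank (ZMod p) W := by
    rw [Module.natCard_eq_pow_finrank (K := ZMod p) (V := V),
      Module.natCard_eq_pow_finrank (K := ZMod p) (V := W)] at hcard
    simp only [Nat.card_zmod] at hcard
    exact Nat.pow_right_injective (Fact.out : p.Prime).two_le hcard
  obtain ⟨w, hw⟩ := exists_linearIndependent_of_le_finrank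
    (hrank ▸ hv.fintype_card_le_finrank : Fintype.card ι ≤ Module.finrank (ZMod p) W)
  exact ⟨i.comp (Fintype.linearCombination (ZMod p) w).toAddMonoidHom,
    hi.comp (linearIndependent_iff_injective_fintypeLinearCombination.1 hw)⟩

lemma linearIndependent_of_separated {K V : Type*} [AddCommGroup K] {p : ℕ}
    [Fact p.Prime] [AddCommGroup V] [Module (ZMod p) V] (π : K →+ V)
    (hker : π.ker = (nsmulAddMonoidHom (α := K) p).range)
    {ι : Type*} (t : ι → K) (H : ι → AddSubgroup K)
    (hH : ∀ i x, p • x ∈ H i) (hne : ∀ i j, j ≠ i → t j ∈ H i) (hself : ∀ i, t i ∉ H i) :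
    LinearIndependent (ZMod p) (π ∘ t) := by
  refine linearIndependent_iff_notMem_span.2 fun i hi => ?_
  have hsub : Submodule.span (ZMod p) ((π ∘ t) '' (Set.univ \ {i})) ≤
      AddSubgroup.toZModSubmodule p ((H i).map π) := by
    rw [Submodule.span_le]
    rintro _ ⟨j, hj, rfl⟩
    exact ⟨t j, hne i j hj.2, rfl⟩
  obtain ⟨x, hx, hxt⟩ := hsub hi
  have hmem : t i - x ∈ π.ker := by simpa [sub_eq_zero] using hxt.symm
  rw [hker] at hmem
  obtain ⟨y, hy⟩ := hmem
  refine hself i ?_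
  rw [← sub_add_cancel (t i) x, ← hy]
  exact add_mem (hH i y) hx

/-- A family that is independent modulo `p` (as witnessed by subgroups containing `pK`) yields an
elementary abelian `p`-subgroup of the corresponding rank. -/
lemma exists_injective_of_separated {K : Type*} [AddCommGroup K] [Finite K] {p : ℕ}
    (hp : p.Prime) {ι : Type*} [Fintype ι] (t : ι → K) (H : ι → AddSubgroup K)
    (hH : ∀ i x, p • x ∈ H i) (hne : ∀ i j, j ≠ i → t j ∈ H i) (hself : ∀ i, t i ∉ H i) :
    ∃ f : (Fin (Fintype.card ι) → ZMod p) →+ K, Function.Injective f := by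
  have : Fact p.Prime := ⟨hp⟩
  set N : K →+ K := nsmulAddMonoidHom p
  have hV : ∀ x : K ⧸ N.range, p • x = 0 := fun x => by
    obtain ⟨x, rfl⟩ := QuotientAddGroup.mk'_surjective N.range x
    rw [← map_nsmul]
    exact (QuotientAddGroup.eq_zero_iff _).2 ⟨x, rfl⟩
  have hW : ∀ x : N.ker, p • x = 0 := fun x => Subtype.ext x.2
  let instV := AddCommGroup.zmodModule hV
  let instW := AddCommGroup.zmodModule hW
  exact exists_injective_of_linearIndependent (QuotientAddGroup.mk' N.range)
    (QuotientAddGroup.mk'_surjective _) (QuotientAddGroup.ker_mk' _) N.ker.subtype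
    N.ker.subtype_injective N.ker.range_subtype
    (linearIndependent_of_separated _ (QuotientAddGroup.ker_mk' _) t H hH hne hself)

lemma exists_multiset_of_mem_closure {G : Type*} [AddCommGroup G] [Finite G] {S : Set G} {x : G}
    (hx : x ∈ AddSubgroup.closure S) : ∃ M : Multiset G, (∀ g ∈ M, g ∈ S) ∧ M.sum = x := by
  rw [← AddSubgroup.mem_toAddSubmonoid, AddSubgroup.closure_toAddSubmonoid_of_finite] at hx
  exact AddSubmonoid.exists_multiset_of_mem_closure hx

/-- If `A` is an atom over `G₀ \ {h'}` through `h` in which the multiplicity of `h` is minimal among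
all atoms avoiding some element of `G₀`, then this multiplicity divides every `k` with
`k • h ∈ ⟨G₀ \ {h, t}⟩`, for `t` outside the support of `A`. -/
lemma count_dvd_of_minimal {G : Type*} [AddCommGroup G] [Finite G] [DecidableEq G] {G₀ : Set G}
    {h t : G} (hh : h ∈ G₀) (ht : t ≠ h) {A : Multiset G} (hA : IsZeroSumSeq G₀ A) (hhA : h ∈ A)
    (htA : t ∉ A)
    (hmin : ∀ A', IsAtomSeq (G₀ \ {t}) A' → h ∈ A' → A.count h ≤ A'.count h)
    {k : ℤ} (hk : k • h ∈ AddSubgroup.closure (G₀ \ {h, t})) : (A.count h : ℤ) ∣ k := by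
  set c := A.count h
  set H := AddSubgroup.closure (G₀ \ {h, t})
  have hc : c • h ∈ H := by
    have hsplit : A = Multiset.replicate c h + A.filter (fun x => ¬ h = x) := by
      rw [← Multiset.filter_eq, Multiset.filter_add_not]
    have hsum := hA.2
    rw [hsplit, Multiset.sum_add, Multiset.sum_replicate] at hsum
    rw [eq_neg_of_add_eq_zero_left hsum]
    refine neg_mem (multiset_sum_mem _ fun g hg => ?_)
    rw [Multiset.mem_filter] at hg
    refine AddSubgroup.subset_closure ⟨hA.1 g hg.1, ?_⟩
    rintro (rfl | rfl)
    exacts [hg.2 rfl, htA hg.1]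
  have hc0 : 0 < c := Multiset.count_pos.2 hhA
  obtain ⟨d, hd⟩ : ∃ d, d = Int.gcd c k := ⟨_, rfl⟩
  have hdc : d ∣ c := by
    have := Int.gcd_dvd_left (c : ℤ) k
    rw [← hd] at this
    exact_mod_cast this
  have hd0 : 0 < d := Nat.pos_of_dvd_of_pos hdc hc0
  have hdH : d • h ∈ H := by
    have hb := Int.gcd_eq_gcd_ab (c : ℤ) k
    rw [← natCast_zsmul, hd, hb, add_zsmul, mul_comm, mul_zsmul, mul_comm k, mul_zsmul,
      natCast_zsmul]
    exact add_mem (zsmul_mem hc _) (zsmul_mem hk _)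
  obtain ⟨M, hM, hMs⟩ := exists_multiset_of_mem_closure (neg_mem hdH)
  have hB : IsZeroSumSeq (G₀ \ {t}) (Multiset.replicate d h + M) := by
    refine ⟨fun g hg => ?_, by simp [hMs]⟩
    rcases Multiset.mem_add.1 hg with hg | hg
    · rw [Multiset.eq_of_mem_replicate hg]
      exact ⟨hh, fun he => ht he.symm⟩
    · exact ⟨(hM g hg).1, fun he => (hM g hg).2 (Or.inr he)⟩
  obtain ⟨A', hA'B, hA', hhA'⟩ := exists_isAtomSeq_le hB (h := h)
    (Multiset.mem_add.2 (Or.inl (Multiset.mem_replicate.2 ⟨hd0.ne', rfl⟩)))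
  have hMh : M.count h = 0 := Multiset.count_eq_zero.2 fun hm => (hM h hm).2 (Or.inl rfl)
  have hle : A'.count h ≤ d := by
    simpa [hMh] using Multiset.count_le_of_le h hA'B
  have hcd : c = d := le_antisymm ((hmin A' hA' hhA').trans hle) (Nat.le_of_dvd hc0 hdc)
  rw [hcd, hd]
  exact Int.gcd_dvd_right _ _

/-- If no element of `G₀` is generated by the others with a further element left out, then all
multiplicities in an atom avoiding some element of `G₀` are at least two. -/
lemma two_le_count {G : Type*} [AddCommGroup G] [DecidableEq G] {G₀ : Set G} {h' : G}
    (hh' : h' ∈ G₀)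
    (hgen : ∀ h ∈ G₀, ∀ h' ∈ G₀ \ {h}, h ∉ AddSubgroup.closure (G₀ \ {h, h'}))
    {A : Multiset G} (hA : IsZeroSumSeq (G₀ \ {h'}) A) {x : G} (hx : x ∈ A) :
    2 ≤ A.count x := by
  have hpos := Multiset.count_pos.2 hx
  by_contra hlt
  have h1 : A.count x = 1 := by omega
  have hxG := hA.1 x hx
  refine hgen x hxG.1 h' ⟨hh', fun he => hxG.2 he.symm⟩ ?_
  obtain ⟨M, rfl⟩ := Multiset.exists_cons_of_mem hx
  have hsum := hA.2
  rw [Multiset.sum_cons] at hsum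
  rw [Multiset.count_cons_self] at h1
  have hneg : -M.sum ∈ AddSubgroup.closure (G₀ \ {x, h'}) := by
    refine neg_mem (multiset_sum_mem _ fun g hg =>
      AddSubgroup.subset_closure ⟨(hA.1 g (Multiset.mem_cons_of_mem hg)).1, ?_⟩)
    rintro (rfl | he)
    · exact Multiset.count_eq_zero.1 (by omega) hg
    · exact (hA.1 g (Multiset.mem_cons_of_mem hg)).2 he
  rwa [← eq_neg_of_add_eq_zero_left hsum] at hneg

/-- A set of elements `t`, each of which together with `h` is indispensable for generating
`⟨G₀⟩` modulo `p⟨G₀⟩`, has at most as many elements as the rank of the group. -/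
lemma card_le_grank_of_notMem_sup {G : Type*} [AddCommGroup G] [Finite G] {G₀ : Set G} {h : G}
    (hh : h ∈ AddSubgroup.closure (G₀ \ {h})) {p : ℕ} (hp : p.Prime)
    (T : Finset G) (hTG : ↑T ⊆ G₀ \ {h})
    (hT : ∀ t ∈ T, h ∉ AddSubgroup.closure (G₀ \ {h, t}) ⊔
      (AddSubgroup.closure G₀).map (nsmulAddMonoidHom p)) :
    T.card ≤ grank G := by
  set K := AddSubgroup.closure G₀
  set P := K.map (nsmulAddMonoidHom p)
  obtain ⟨f, hf⟩ := exists_injective_of_separated (K := K) hp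
    (fun t : T => ⟨t, AddSubgroup.subset_closure (hTG t.2).1⟩)
    (fun t => (AddSubgroup.closure (G₀ \ {h, ↑t}) ⊔ P).comap K.subtype)
    (fun t x => AddSubgroup.mem_sup_right ⟨x, x.2, rfl⟩)
    (fun t s hst => AddSubgroup.mem_sup_left (AddSubgroup.subset_closure ⟨(hTG s.2).1, by
      rintro (he | he)
      exacts [(hTG s.2).2 he, hst (Subtype.ext he)]⟩))
    (fun t ht => hT t t.2 (by
      refine (AddSubgroup.closure_le _).2 (fun g hg => ?_) hh
      by_cases hgt : g = t
      · exact hgt ▸ ht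
      · refine AddSubgroup.mem_sup_left (AddSubgroup.subset_closure ⟨hg.1, ?_⟩)
        rintro (he | he)
        exacts [hg.2 he, hgt he]))
  rw [← Fintype.card_coe]
  exact le_grank_of_injective hp (K.subtype.comp f) (K.subtype_injective.comp hf)

/-- Some atom avoids an element of `G₀`, but at most `grank G` elements of `G₀` altogether. -/
lemma exists_isAtomSeq_large_support {G : Type*} [AddCommGroup G] [Finite G] [DecidableEq G]
    {G₀ : Set G} (hnt : G₀.Nontrivial)
    (hgen : ∀ h ∈ G₀, h ∈ AddSubgroup.closure (G₀ \ {h}) ∧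
      ∀ h' ∈ G₀ \ {h}, h ∉ AddSubgroup.closure (G₀ \ {h, h'})) :
    ∃ h' ∈ G₀, ∃ A, IsAtomSeq (G₀ \ {h'}) A ∧ G₀.ncard ≤ A.toFinset.card + grank G := by
  obtain ⟨h, hh, h₁, hh₁, hne⟩ := hnt
  have hex : ∃ c, ∃ h' ∈ G₀, ∃ A, IsAtomSeq (G₀ \ {h'}) A ∧ h ∈ A ∧ A.count h = c :=
    ⟨_, h₁, hh₁, _, isAtomSeq_replicate_addOrderOf (g := h) ⟨hh, hne⟩,
      Multiset.mem_replicate.2 ⟨(addOrderOf_pos h).ne', rfl⟩, rfl⟩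
  classical
  obtain ⟨h', hh', A, hA, hhA, hAc⟩ := Nat.find_spec hex
  have hmin : ∀ t ∈ G₀, ∀ A', IsAtomSeq (G₀ \ {t}) A' → h ∈ A' → A.count h ≤ A'.count h :=
    fun t ht A' hA' hhA' => hAc ▸ Nat.find_min' hex ⟨t, ht, A', hA', hhA', rfl⟩
  refine ⟨h', hh', A, hA, ?_⟩
  have hc2 := two_le_count hh' (fun h hh => (hgen h hh).2) hA.1 hhA
  obtain ⟨p, hp, hpc⟩ := Nat.exists_prime_and_dvd (n := A.count h) (by omega)
  set T : Finset G := G₀.toFinite.toFinset \ A.toFinset with hTdef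
  have hT : ∀ t, t ∈ T ↔ t ∈ G₀ ∧ t ∉ A := by simp [hTdef]
  have hTG : (T : Set G) ⊆ G₀ \ {h} := fun t ht =>
    ⟨((hT t).1 ht).1, fun he => ((hT t).1 ht).2 (he ▸ hhA)⟩
  have hcard : T.card ≤ grank G := by
    refine card_le_grank_of_notMem_sup (hgen h hh).1 hp T hTG fun t ht hmem => ?_
    obtain ⟨x, hx, _, ⟨y, hy, rfl⟩, hxy⟩ := AddSubgroup.mem_sup.1 hmem
    have hKle : AddSubgroup.closure G₀ ≤
        AddSubgroup.closure (G₀ \ {h, t}) ⊔ AddSubgroup.zmultiples h := by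
      have htK : AddSubgroup.closure (G₀ \ {t}) ≤
          AddSubgroup.closure (G₀ \ {h, t}) ⊔ AddSubgroup.zmultiples h := by
        refine (AddSubgroup.closure_le _).2 fun g hg => ?_
        by_cases hgh : g = h
        · exact AddSubgroup.mem_sup_right (hgh ▸ AddSubgroup.mem_zmultiples h)
        · refine AddSubgroup.mem_sup_left (AddSubgroup.subset_closure ⟨hg.1, ?_⟩)
          rintro (he | he)
          exacts [hgh he, hg.2 he]
      refine (AddSubgroup.closure_le _).2 fun g hg => ?_
      by_cases hgt : g = t
      · exact hgt ▸ htK (hgen t (hTG ht).1).1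
      · exact htK (AddSubgroup.subset_closure ⟨hg, hgt⟩)
    obtain ⟨z, hz, _, ⟨j, rfl⟩, rfl⟩ := AddSubgroup.mem_sup.1 (hKle hy)
    have hk : (1 - p * j : ℤ) • h ∈ AddSubgroup.closure (G₀ \ {h, t}) := by
      have : (1 - p * j : ℤ) • h = x + p • z := by
        have hxy' : x + p • (z + j • h) = h := hxy
        rw [sub_zsmul, one_zsmul, mul_zsmul, natCast_zsmul]
        nth_rewrite 1 [← hxy']
        rw [nsmul_add]
        abel
      exact this ▸ add_mem hx (nsmul_mem hz p)
    have hdvd := count_dvd_of_minimal hh (hTG ht).2 ⟨fun g hg => (hA.1.1 g hg).1, hA.1.2⟩ hhA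
      ((hT t).1 ht).2 (hmin t (hTG ht).1) hk
    have hp1 : (p : ℤ) ∣ 1 := by
      have h1 : (p : ℤ) ∣ 1 - p * j := (Int.natCast_dvd_natCast.2 hpc).trans hdvd
      simpa using dvd_add h1 (dvd_mul_right (p : ℤ) j)
    exact hp.one_lt.ne' (by exact_mod_cast Int.eq_one_of_dvd_one (by positivity) hp1)
  have hsub : G₀.toFinite.toFinset ⊆ A.toFinset ∪ T := fun g hg => by
    by_cases hgA : g ∈ A <;> simp_all
  rw [Set.ncard_eq_toFinset_card G₀]
  exact ((Finset.card_le_card hsub).trans (Finset.card_union_le _ _)).trans (by omega)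

theorem stmt_8 {G : Type*} [AddCommGroup G] [Fintype G] (n r : ℕ)
    (hn : AddMonoid.exponent G = n) (hr : grank G = r) (G₀ : Set G)
    (hnhf : DeltaSet G₀ ≠ ∅) (hminimal : ∀ G₁ : Set G, G₁ ⊂ G₀ → DeltaSet G₁ = ∅)
    (hlcn : IsLCNSet G₀) (hcard : r + 2 ≤ G₀.ncard)
    (hgen : ∀ h ∈ G₀, h ∈ AddSubgroup.closure (G₀ \ {h}) ∧
      ∀ h' ∈ G₀ \ {h}, h ∉ AddSubgroup.closure (G₀ \ {h, h'})) :
    (G₀.ncard : ℚ) ≤ r + n / 2 := by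
  classical
  subst hn hr
  have hnt : G₀.Nontrivial := (Set.one_lt_ncard_iff_nontrivial).1 (by omega)
  obtain ⟨h', hh', A, hA, hle⟩ := exists_isAtomSeq_large_support hnt hgen
  have hexp := hA.card_le_exponent (hminimal _ (Set.sdiff_singleton_ssubset.2 hh'))
  have h2 : A.toFinset.card * 2 ≤ A.card := by
    rw [← Multiset.toFinset_sum_count_eq, ← smul_eq_mul]
    exact Finset.card_nsmul_le_sum _ _ _ fun x hx =>
      two_le_count hh' (fun h hh => (hgen h hh).2) hA.1 (Multiset.mem_toFinset.1 hx)
  have hnat : 2 * G₀.ncard ≤ 2 * grank G + AddMonoid.exponent G := by omega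
  have hrat : (2 : ℚ) * G₀.ncard ≤ 2 * grank G + AddMonoid.exponent G := by exact_mod_cast hnat
  linarith
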